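/- Let N be a seminorm on ℝᵈ taking integer values on ℤᵈ, and let B*_N = {y ∈ ℝᵈ : ⟨x,y⟩ ≤ N(x) for all x ∈ ℝᵈ} be its dual unit ball. Then every extreme point of B*_N belongs to ℤᵈ. -/

import Mathlib

/-- `N` is a seminorm on `ℝᵈ = Fin d → ℝ`: absolutely homogeneous and subadditive. -/
def IsSeminorm {d : ℕ} (N : (Fin d → ℝ) → ℝ) : Prop :=
  (∀ (c : ℝ) (x : Fin d → ℝ), N (c • x) = |c| * N x) ∧
  ∀ x y : Fin d → ℝ, N (x + y) ≤ N x + N y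

/-- An integer-valued sublinear functional on an abelian group. -/
structure IntSublinear {G : Type*} [AddCommGroup G] (p : G → ℤ) : Prop where
  add_le : ∀ x y, p (x + y) ≤ p x + p y
  map_nsmul : ∀ (n : ℕ) x, p (n • x) = n * p x

/-- A bounded below antitone sequence of integers is eventually constant. -/
lemma Antitone.exists_eventually_const_int {f : ℕ → ℤ} (hf : Antitone f) {b : ℤ}
    (hb : ∀ n, b ≤ f n) : ∃ (c : ℤ) (n₀ : ℕ), ∀ n ≥ n₀, f n = c := by
  obtain ⟨c, ⟨n₀, hn₀⟩, hc⟩ := Int.exists_least_of_bdd (P := fun z => ∃ n, f n = z)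
    ⟨b, by rintro z ⟨n, rfl⟩; exact hb n⟩ ⟨f 0, 0, rfl⟩
  exact ⟨c, n₀, fun n hn => le_antisymm (hn₀ ▸ hf hn) (hc _ ⟨n, rfl⟩)⟩

namespace IntSublinear

variable {G : Type*} [AddCommGroup G] {p : G → ℤ}

lemma map_zero (hp : IntSublinear p) : p 0 = 0 := by
  simpa using hp.map_nsmul 0 0

lemma neg_le (hp : IntSublinear p) (x : G) : 0 ≤ p x + p (-x) := by
  simpa [hp.map_zero] using hp.add_le x (-x)

lemma exists_eventually_eq (hp : IntSublinear p) (a x : G) :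
    ∃ (c : ℤ) (n₀ : ℕ), ∀ n ≥ n₀, p (x + n • a) - n * p a = c := by
  refine Antitone.exists_eventually_const_int (f := fun n : ℕ => p (x + n • a) - n * p a)
    (b := -p (-x)) (antitone_nat_of_succ_le fun n => ?_) fun n => ?_
  · have h := hp.add_le (x + n • a) a
    have e : x + (n + 1) • a = x + n • a + a := by rw [succ_nsmul, add_assoc]
    simp only [e]
    push_cast
    linarith
  · have h := hp.add_le (x + n • a) (-x)
    have e : x + n • a + -x = n • a := by abel
    rw [e, hp.map_nsmul] at h
    linarith

/-- The directional derivative of a sublinear functional at `a` is a smaller sublinear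
functional which is linear along `a`. -/
lemma exists_le_of_direction (hp : IntSublinear p) (a : G) :
    ∃ q : G → ℤ, IntSublinear q ∧ (∀ x, q x ≤ p x) ∧ q (-a) = -p a := by
  choose q n₀ hq using hp.exists_eventually_eq a
  refine ⟨q, ⟨fun x y => ?_, fun m x => ?_⟩, fun x => ?_, ?_⟩
  · set n := n₀ x + n₀ y + n₀ (x + y) with hn
    have hx := hq x n (by omega)
    have hy := hq y n (by omega)
    have hxy := hq (x + y) (n + n) (by omega)
    have h := hp.add_le (x + n • a) (y + n • a)
    have e : x + n • a + (y + n • a) = x + y + (n + n) • a := by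
      rw [add_nsmul a n n, add_add_add_comm]
    rw [e] at h
    push_cast at hxy
    linarith
  · rcases Nat.eq_zero_or_pos m with rfl | hm
    · have h := hq 0 (n₀ 0) le_rfl
      simp [hp.map_nsmul] at h
      simp [← h]
    · set n := n₀ x + n₀ (m • x) with hn
      have hx := hq x n (by omega)
      have hmx := hq (m • x) (m * n) (by nlinarith)
      have e : m • x + (m * n) • a = m • (x + n • a) := by rw [nsmul_add, mul_nsmul']
      rw [e, hp.map_nsmul] at hmx
      rw [← hmx, ← hx]
      push_cast
      ring
  · have h := hq x (n₀ x) le_rfl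
    have h' := hp.add_le x (n₀ x • a)
    rw [hp.map_nsmul] at h'
    linarith
  · have h := hq (-a) (n₀ (-a) + 1) (by omega)
    have e : -a + (n₀ (-a) + 1) • a = n₀ (-a) • a := by rw [succ_nsmul]; abel
    rw [e, hp.map_nsmul] at h
    rw [← h]
    push_cast
    ring

lemma exists_le_of_finset (hp : IntSublinear p) (s : Finset G) :
    ∃ q : G → ℤ, IntSublinear q ∧ (∀ x, q x ≤ p x) ∧ ∀ x ∈ s, q x + q (-x) ≤ 0 := by
  classical
  induction s using Finset.induction_on with
  | empty => exact ⟨p, hp, fun _ => le_rfl, by simp⟩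
  | insert a s _ ih =>
    obtain ⟨q, hq, hqp, hqs⟩ := ih
    obtain ⟨r, hr, hrq, hra⟩ := hq.exists_le_of_direction a
    refine ⟨r, hr, fun x => (hrq x).trans (hqp x), fun x hx => ?_⟩
    rcases Finset.mem_insert.1 hx with rfl | hx
    · linarith [hrq x]
    · linarith [hrq x, hrq (-x), hqs x hx]

/-- The subgroup on which a sublinear functional is odd, hence additive. -/
def oddSubgroup (hp : IntSublinear p) : AddSubgroup G where
  carrier := {x | p x + p (-x) ≤ 0}
  zero_mem' := by simp [hp.map_zero]
  neg_mem' {x} hx := by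
    simp only [Set.mem_ofPred_eq, neg_neg] at hx ⊢
    linarith
  add_mem' {x y} hx hy := by
    simp only [Set.mem_ofPred_eq, neg_add] at hx hy ⊢
    linarith [hp.add_le x y, hp.add_le (-x) (-y)]

/-- Integral Hahn–Banach theorem: on a finitely generated abelian group, an integer-valued
sublinear functional is supported at every point by an integer-valued homomorphism. -/
theorem exists_addMonoidHom [AddGroup.FG G] (hp : IntSublinear p) (a : G) :
    ∃ f : G →+ ℤ, (∀ x, f x ≤ p x) ∧ f a = p a := by
  obtain ⟨q, hq, hqp, hqa⟩ := hp.exists_le_of_direction a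
  obtain ⟨s, hs⟩ := AddGroup.fg_def.1 ‹AddGroup.FG G›
  obtain ⟨r, hr, hrq, hrs⟩ := hq.exists_le_of_finset s
  have htop : hr.oddSubgroup = ⊤ := top_unique (hs ▸ (AddSubgroup.closure_le _).2 hrs)
  have hodd (x : G) : r x + r (-x) ≤ 0 := by
    have : x ∈ hr.oddSubgroup := htop ▸ AddSubgroup.mem_top x
    exact this
  refine ⟨AddMonoidHom.mk' r fun x y => le_antisymm (hr.add_le x y) ?_,
    fun x => (hrq x).trans (hqp x), le_antisymm ((hrq a).trans (hqp a)) ?_⟩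
  · have h := hr.add_le (-x) (-y)
    rw [← neg_add] at h
    linarith [hodd x, hodd y, hr.neg_le (x + y), hr.neg_le x, hr.neg_le y]
  · change p a ≤ r a
    linarith [hr.neg_le a, hrq (-a)]

end IntSublinear

open Filter Topology in
/-- A closed cone containing the integer lattice is the whole space. -/
lemma IsClosed.eq_univ_of_intCast_mem {ι : Type*} {C : Set (ι → ℝ)} (hC : IsClosed C)
    (hcone : ∀ c : ℝ, 0 ≤ c → ∀ x ∈ C, c • x ∈ C)
    (hint : ∀ a : ι → ℤ, (fun i => (a i : ℝ)) ∈ C) (x : ι → ℝ) : x ∈ C := by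
  have hlim : Tendsto (fun k : ℕ => (k : ℝ)⁻¹ • fun i => (⌊(k : ℝ) * x i⌋ : ℝ)) atTop (𝓝 x) := by
    refine tendsto_pi_nhds.2 fun i => ?_
    have h0 : Tendsto (fun k : ℕ => x i - (k : ℝ)⁻¹) atTop (𝓝 (x i)) := by
      simpa using tendsto_const_nhds.sub (tendsto_inv_atTop_nhds_zero_nat (𝕜 := ℝ))
    refine tendsto_of_tendsto_of_tendsto_of_le_of_le' h0 tendsto_const_nhds ?_ ?_
    all_goals
      filter_upwards [eventually_gt_atTop 0] with k hk
      have hk' : (0 : ℝ) < k := by exact_mod_cast hk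
      have e : x i = (k : ℝ)⁻¹ * (k * x i) := by field_simp
      simp only [Pi.smul_apply, smul_eq_mul]
    · have := mul_le_mul_of_nonneg_left (Int.sub_one_lt_floor ((k : ℝ) * x i)).le
        (inv_nonneg.2 hk'.le)
      rw [mul_sub, ← e, mul_one] at this
      exact this
    · have := mul_le_mul_of_nonneg_left (Int.floor_le ((k : ℝ) * x i)) (inv_nonneg.2 hk'.le)
      rwa [← e] at this
  exact hC.mem_of_tendsto hlim (.of_forall fun k => hcone _ (by positivity) _ (hint _))

lemma IsSeminorm.continuous {d : ℕ} {N : (Fin d → ℝ) → ℝ} (hN : IsSeminorm N) :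
    Continuous N := by
  have hconv : ConvexOn ℝ Set.univ N := by
    refine ⟨convex_univ, fun x _ y _ a b ha hb _ => (hN.2 _ _).trans_eq ?_⟩
    rw [hN.1, hN.1, abs_of_nonneg ha, abs_of_nonneg hb, smul_eq_mul, smul_eq_mul]
  exact continuousOn_univ.1 (hconv.continuousOn isOpen_univ)

/-- At every lattice vector, a seminorm integral on the lattice is attained by an integral point
of the dual unit ball. -/
lemma IsSeminorm.exists_int_dual {d : ℕ} {N : (Fin d → ℝ) → ℝ} (hN : IsSeminorm N)
    (h_int : ∀ a : Fin d → ℤ, ∃ m : ℤ, N (fun i => (a i : ℝ)) = (m : ℝ)) (a : Fin d → ℤ) :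
    ∃ b : Fin d → ℤ, (∀ x : Fin d → ℝ, ∑ i, x i * (b i : ℝ) ≤ N x) ∧
      N (fun i => (a i : ℝ)) = ∑ i, (a i : ℝ) * (b i : ℝ) := by
  choose p hp using h_int
  have hsub : IntSublinear p := by
    refine ⟨fun x y => ?_, fun n x => ?_⟩
    · have h := hN.2 (fun i => (x i : ℝ)) (fun i => (y i : ℝ))
      rw [hp, hp] at h
      have e := hp (x + y)
      have e' : (fun i => (((x + y) i : ℤ) : ℝ)) =
        (fun i => (x i : ℝ)) + (fun i => (y i : ℝ)) := by ext i; simp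
      rw [e'] at e
      rw [e] at h
      exact_mod_cast h
    · have h := hN.1 n (fun i => (x i : ℝ))
      have e' : (n : ℝ) • (fun i => (x i : ℝ)) = fun i => (((n • x) i : ℤ) : ℝ) := by
        ext i; simp
      rw [e', hp, hp, Nat.abs_cast] at h
      exact_mod_cast h
  have : AddGroup.FG (Fin d → ℤ) :=
    AddGroup.fg_iff_addMonoid_fg.2 (Module.Finite.iff_addMonoid_fg.1 inferInstance)
  obtain ⟨f, hf, hfa⟩ := hsub.exists_addMonoidHom a
  have hrep (x : Fin d → ℤ) : f x = ∑ i, x i * f (Pi.single i 1) := by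
    have := f.toIntLinearMap.pi_apply_eq_sum_univ x
    have e (i : Fin d) : (fun j => if i = j then (1 : ℤ) else 0) = Pi.single i 1 := by
      ext j
      simp [Pi.single_apply, eq_comm]
    simpa [e] using this
  refine ⟨fun i => f (Pi.single i 1), fun x => ?_, ?_⟩
  · refine IsClosed.eq_univ_of_intCast_mem
      (C := {x : Fin d → ℝ | ∑ i, x i * (f (Pi.single i 1) : ℝ) ≤ N x})
      (isClosed_le (by fun_prop) hN.continuous) (fun c hc x hx => ?_) (fun z => ?_) x
    · simp only [Set.mem_ofPred_eq, Pi.smul_apply, smul_eq_mul, mul_assoc, ← Finset.mul_sum] at hx ⊢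
      rw [hN.1, abs_of_nonneg hc]
      exact mul_le_mul_of_nonneg_left hx hc
    · have h := hf z
      rw [hrep] at h
      simp only [Set.mem_ofPred_eq, hp]
      exact_mod_cast h
  · rw [hp, ← hfa, hrep]
    push_cast
    rfl

lemma convex_dualBall {d : ℕ} (N : (Fin d → ℝ) → ℝ) :
    Convex ℝ {y : Fin d → ℝ | ∀ x, ∑ i, x i * y i ≤ N x} := by
  intro y hy z hz s t hs ht hst x
  calc ∑ i, x i * (s • y + t • z) i = s * ∑ i, x i * y i + t * ∑ i, x i * z i := by
        rw [Finset.mul_sum, Finset.mul_sum, ← Finset.sum_add_distrib]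
        refine Finset.sum_congr rfl fun i _ => ?_
        simp only [Pi.add_apply, Pi.smul_apply, smul_eq_mul]
        ring
    _ ≤ s * N x + t * N x := by gcongr; exacts [hy x, hz x]
    _ = N x := by rw [← add_mul, hst, one_mul]

/-- The dual unit ball of a function contains only finitely many integral points. -/
lemma finite_int_dualBall {d : ℕ} (N : (Fin d → ℝ) → ℝ) :
    {b : Fin d → ℤ | ∀ x : Fin d → ℝ, ∑ i, x i * (b i : ℝ) ≤ N x}.Finite := by
  refine (Set.finite_Icc (fun i => -⌊N (Pi.single i (-1))⌋)
    (fun i => ⌊N (Pi.single i 1)⌋)).subset fun b hb => ⟨fun i => ?_, fun i => ?_⟩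
  · have h := hb (Pi.single i (-1))
    simp [Pi.single_apply] at h
    have : -b i ≤ ⌊N (Pi.single i (-1))⌋ := Int.le_floor.2 (by push_cast; linarith)
    simp only
    linarith
  · have h := hb (Pi.single i 1)
    simp [Pi.single_apply] at h
    exact Int.le_floor.2 h

/-- every extreme point of the dual unit ball
`B*_N = {y | ∀ x, ⟨x,y⟩ ≤ N x}` of a seminorm taking integer values on `ℤᵈ`
belongs to the integer lattice `ℤᵈ`. -/
theorem statement_5 (d : ℕ) (N : (Fin d → ℝ) → ℝ)
    (hN : IsSeminorm N)
    (h_int : ∀ a : Fin d → ℤ, ∃ m : ℤ, N (fun i => (a i : ℝ)) = (m : ℝ)) :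
    ∀ y ∈ Set.extremePoints ℝ {y : Fin d → ℝ | ∀ x, ∑ i, x i * y i ≤ N x},
      ∀ i, ∃ m : ℤ, y i = (m : ℝ) := by
  intro y hy
  set T := {b : Fin d → ℤ | ∀ x : Fin d → ℝ, ∑ i, x i * (b i : ℝ) ≤ N x} with hT
  have hTfin : T.Finite := finite_int_dualBall N
  set S : Set (Fin d → ℝ) := (fun b i => (b i : ℝ)) '' T with hS
  have hsupp (x : Fin d → ℝ) : ∃ b ∈ T, N x ≤ ∑ i, x i * (b i : ℝ) := by
    have hx := IsClosed.eq_univ_of_intCast_mem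
      (C := ⋃ b ∈ T, {x : Fin d → ℝ | N x ≤ ∑ i, x i * (b i : ℝ)})
      (hTfin.isClosed_biUnion fun b _ => isClosed_le hN.continuous (by fun_prop))
      (fun c hc x hx => ?_) (fun a => ?_) x
    · simpa using hx
    · simp only [Set.mem_iUnion, Set.mem_ofPred_eq, exists_prop] at hx ⊢
      obtain ⟨b, hb, hxb⟩ := hx
      refine ⟨b, hb, ?_⟩
      simp only [Pi.smul_apply, smul_eq_mul, mul_assoc, ← Finset.mul_sum]
      rw [hN.1, abs_of_nonneg hc]
      exact mul_le_mul_of_nonneg_left hxb hc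
    · obtain ⟨b, hb, hab⟩ := hN.exists_int_dual h_int a
      simp only [Set.mem_iUnion, Set.mem_ofPred_eq, exists_prop]
      exact ⟨b, hb, hab.le⟩
  have hyS : y ∈ convexHull ℝ S := by
    by_contra hyS
    obtain ⟨f, u, hfu, huy⟩ := geometric_hahn_banach_closed_point (convex_convexHull ℝ S)
      ((hTfin.image _).isCompact_convexHull (𝕜 := ℝ)).isClosed hyS
    have hf (z : Fin d → ℝ) : f z = ∑ i, f (Pi.single i 1) * z i := by
      have := f.toLinearMap.pi_apply_eq_sum_univ z
      have e (i : Fin d) : (fun j => if i = j then (1 : ℝ) else 0) = Pi.single i 1 := by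
        ext j
        simp [Pi.single_apply, eq_comm]
      simpa [e, mul_comm] using this
    obtain ⟨b, hb, hbx⟩ := hsupp fun i => f (Pi.single i 1)
    have h1 := hfu _ (subset_convexHull ℝ S ⟨b, hb, rfl⟩)
    have h2 := hy.1 fun i => f (Pi.single i 1)
    rw [hf] at h1 huy
    linarith
  have hsub : convexHull ℝ S ⊆ {y : Fin d → ℝ | ∀ x, ∑ i, x i * y i ≤ N x} :=
    convexHull_min (by rintro _ ⟨b, hb, rfl⟩; exact hb) (convex_dualBall N)
  obtain ⟨b, -, rfl⟩ := extremePoints_convexHull_subset (𝕜 := ℝ)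
    (inter_extremePoints_subset_extremePoints_of_subset (𝕜 := ℝ) hsub ⟨hyS, hy⟩)
  exact fun i => ⟨b i, rfl⟩
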